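/- For every natural number n, 7 does not divide I(n). -/

import Mathlib

/-- Involution numbers via the recurrence. -/
def invRec : ℕ → ℕ
  | 0 => 1
  | 1 => 1
  | n + 2 => invRec (n + 1) + (n + 1) * invRec n

/-- `I(n) mod 7` is periodic with period 7. -/
theorem invRec_add_seven (n : ℕ) :
    (invRec (n + 7) : ZMod 7) = invRec n ∧ (invRec (n + 8) : ZMod 7) = invRec (n + 1) := by
  induction n with
  | zero => exact ⟨by decide, by decide⟩
  | succ n ih =>
    obtain ⟨h1, h2⟩ := ih
    refine ⟨h2, ?_⟩
    have e1 : invRec (n + 1 + 8) = invRec (n + 8) + (n + 8) * invRec (n + 7) := by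
      rw [show n + 1 + 8 = (n + 7) + 2 by ring, invRec]
    have e2 : invRec (n + 1 + 1) = invRec (n + 1) + (n + 1) * invRec n := by
      rw [invRec]
    have h8 : (8 : ZMod 7) = 1 := by decide
    rw [e1, e2]
    push_cast
    rw [h1, h2, h8]

theorem seven_not_dvd_involution (n : ℕ) : ¬ (7 ∣ invRec n) := by
  induction n using Nat.strong_induction_on with
  | _ n ih =>
    by_cases hn : n < 7
    · interval_cases n <;> decide
    · obtain ⟨m, rfl⟩ := Nat.exists_eq_add_of_le' (Nat.le_of_not_lt hn)
      rw [← ZMod.natCast_eq_zero_iff, (invRec_add_seven m).1, ZMod.natCast_eq_zero_iff]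
      exact ih m (by omega)
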